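/- Let m ≥ 2 be an integer and let a be an integer with 0 ≤ a ≤ m−2. For every complex q with 0 < |q| < 1 and every complex x, the absolutely convergent multiple series K_m^{(a)}(x) = Σ_{c_1,…,c_{m−1}=0}^{∞} (−1)^{c_{m−1}} q^{c_{m−1}(c_{m−1}+1)/2} x^{c_1+⋯+c_{m−1}} q^{c_1²+⋯+c_{m−2}² + c_{a+1}+⋯+c_{m−2}} Π_{i=1}^{m−2} [c_{i+1}+δ_{i,a} choose c_i]_q satisfies K_m^{(a)}(x) = Σ_{k=0}^{∞} ( q^{m k² + (m−1−a)k} x^{m k} − q^{m k² + (m+1+a)k + 1 + a} x^{m k + 1 + a} ). -/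

import Mathlib

open scoped BigOperators

/-- The Gaussian binomial coefficient `[M choose n]_q`: equal to
`(q)_M/((q)_n (q)_{M−n})` for `M ≥ n ≥ 0` and to `0` otherwise; defined via the
`q`-Pascal recursion (hence an integer polynomial in `q`). -/
def qBinom (q : ℂ) : ℕ → ℕ → ℂ
  | _, 0 => 1
  | 0, _ + 1 => 0
  | M + 1, n + 1 => q ^ (n + 1) * qBinom q M (n + 1) + qBinom q M n

/-- The general term of the multiple series `K_m^{(a)}(x)` with `m = p + 2`:
for `c : Fin (p+1) → ℕ` (where `c j` is `c_{j+1}`, `j = 0,…,p`), the term is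
`(−1)^{c_{m−1}} q^{c_{m−1}(c_{m−1}+1)/2} x^{c_1+⋯+c_{m−1}}
 q^{c_1²+⋯+c_{m−2}² + c_{a+1}+⋯+c_{m−2}} Π_{i=1}^{m−2} [c_{i+1}+δ_{i,a} choose c_i]_q`. -/
noncomputable def Kterm (p a : ℕ) (q x : ℂ) (c : Fin (p + 1) → ℕ) : ℂ :=
  (-1 : ℂ) ^ (c (Fin.last p)) *
    q ^ ((c (Fin.last p) * (c (Fin.last p) + 1)) / 2) *
    x ^ (∑ j : Fin (p + 1), c j) *
    q ^ ((∑ j : Fin p, (c j.castSucc) ^ 2) +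
          ∑ j : Fin p, (if a ≤ (j : ℕ) then c j.castSucc else 0)) *
    ∏ j : Fin p,
      qBinom q (c j.succ + (if (j : ℕ) + 1 = a then 1 else 0)) (c j.castSucc)

/-- The finite `q`-Pochhammer symbol `(A; q)_n`. -/
noncomputable def qPoch (q A : ℂ) (n : ℕ) : ℂ := ∏ k ∈ Finset.range n, (1 - A * q ^ k)

lemma qPoch_zero (q A : ℂ) : qPoch q A 0 = 1 := by simp [qPoch]

lemma qPoch_succ (q A : ℂ) (n : ℕ) : qPoch q A (n + 1) = qPoch q A n * (1 - A * q ^ n) := by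
  simp [qPoch, Finset.prod_range_succ]

lemma qPoch_add (q A : ℂ) (m n : ℕ) :
    qPoch q A (m + n) = qPoch q A m * qPoch q (A * q ^ m) n := by
  simp only [qPoch, Finset.prod_range_add]
  congr 1
  exact Finset.prod_congr rfl fun k _ => by ring

lemma qPoch_succ' (q A : ℂ) (n : ℕ) :
    qPoch q A (n + 1) = (1 - A) * qPoch q (A * q) n := by
  rw [add_comm, qPoch_add]
  simp [qPoch]

lemma qPoch_ne_zero {q A : ℂ} (hA : ∀ k : ℕ, 1 - A * q ^ k ≠ 0) (n : ℕ) : qPoch q A n ≠ 0 :=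
  Finset.prod_ne_zero_iff.2 fun k _ => hA k

lemma one_sub_mul_pow_shift_ne_zero {q A : ℂ} (hA : ∀ k : ℕ, 1 - A * q ^ k ≠ 0) (r : ℕ) (k : ℕ) :
    1 - A * q ^ r * q ^ k ≠ 0 := by
  have := hA (r + k)
  rwa [pow_add, ← mul_assoc] at this

lemma one_sub_self_mul_pow_ne_zero {q : ℂ} (hq1 : ‖q‖ < 1) (k : ℕ) : 1 - q * q ^ k ≠ 0 := by
  intro h
  have h1 : ‖q ^ (k + 1)‖ = 1 := by
    rw [pow_succ', ← sub_eq_zero.1 h, norm_one]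
  rw [norm_pow] at h1
  exact (pow_lt_one₀ (norm_nonneg q) hq1 k.succ_ne_zero).ne h1

lemma qBinom_zero_right (q : ℂ) (M : ℕ) : qBinom q M 0 = 1 := by
  cases M <;> simp [qBinom]

lemma qBinom_eq_zero_of_lt (q : ℂ) : ∀ {M n : ℕ}, M < n → qBinom q M n = 0
  | _, 0, h => absurd h (Nat.not_lt_zero _)
  | 0, _ + 1, _ => by simp [qBinom]
  | M + 1, n + 1, h => by
    rw [qBinom, qBinom_eq_zero_of_lt q (show M < n + 1 by omega),
      qBinom_eq_zero_of_lt q (show M < n by omega)]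
    simp

lemma qBinom_self (q : ℂ) (n : ℕ) : qBinom q n n = 1 := by
  induction n with
  | zero => exact qBinom_zero_right q 0
  | succ n ih => rw [qBinom, ih, qBinom_eq_zero_of_lt q n.lt_succ_self]; simp

lemma qBinom_add_mul_qPoch (q : ℂ) (n k : ℕ) :
    qBinom q (n + k) n * (qPoch q q n * qPoch q q k) = qPoch q q (n + k) := by
  induction n generalizing k with
  | zero => simp [qBinom_zero_right, qPoch_zero]
  | succ n ihn =>
    induction k with
    | zero => simp [qBinom_self, qPoch_zero]
    | succ k ihk =>
      have h1 := ihn (k + 1)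
      rw [show n + 1 + (k + 1) = (n + 1 + k) + 1 by ring, qBinom]
      rw [show n + (k + 1) = n + 1 + k by ring] at h1
      rw [qPoch_succ q q (n + 1 + k)]
      rw [qPoch_succ] at ihk
      rw [qPoch_succ] at h1
      rw [qPoch_succ, qPoch_succ]
      linear_combination (q ^ (n + 1) * (1 - q * q ^ k)) * ihk + (1 - q * q ^ n) * h1

lemma qBinom_add_eq_div {q : ℂ} (hq1 : ‖q‖ < 1) (n k : ℕ) :
    qBinom q (n + k) n = qPoch q q (n + k) / (qPoch q q n * qPoch q q k) := by
  have h := fun n => qPoch_ne_zero (one_sub_self_mul_pow_ne_zero hq1) n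
  rw [eq_div_iff (mul_ne_zero (h _) (h _)), qBinom_add_mul_qPoch]

/-- The other `q`-Pascal recursion. -/
lemma qBinom_succ_succ' {q : ℂ} (hq1 : ‖q‖ < 1) (n k : ℕ) :
    qBinom q (n + k + 1) (n + 1) = qBinom q (n + k) (n + 1) + q ^ k * qBinom q (n + k) n := by
  have h := fun n => qPoch_ne_zero (one_sub_self_mul_pow_ne_zero hq1) n
  have h' := one_sub_self_mul_pow_ne_zero hq1
  rcases k with _ | k
  · simp [qBinom_self, qBinom_eq_zero_of_lt]
  · rw [show n + (k + 1) + 1 = (n + 1) + (k + 1) by ring, qBinom_add_eq_div hq1,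
      qBinom_add_eq_div hq1 n, show n + (k + 1) = (n + 1) + k by ring, qBinom_add_eq_div hq1,
      show n + 1 + (k + 1) = n + 1 + k + 1 by ring, qPoch_succ q q (n + 1 + k), qPoch_succ q q n,
      qPoch_succ q q k]
    have := h n
    have := h k
    have := h' n
    have := h' k
    field_simp
    ring

lemma qBinom_mul_qBinom {q : ℂ} (hq1 : ‖q‖ < 1) (r s t : ℕ) :
    qBinom q (r + s + t) (r + s) * qBinom q (r + s) r =
      qBinom q (r + s + t) r * qBinom q (s + t) s := by
  have h := fun n => qPoch_ne_zero (one_sub_self_mul_pow_ne_zero hq1) n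
  rw [qBinom_add_eq_div hq1, qBinom_add_eq_div hq1, qBinom_add_eq_div hq1,
    show r + s + t = r + (s + t) by ring, qBinom_add_eq_div hq1]
  have := h r
  have := h s
  have := h t
  have := h (r + s)
  have := h (s + t)
  field_simp

lemma sum_qBinom_mul_qPoch {q : ℂ} (hq1 : ‖q‖ < 1) (M : ℕ) (B : ℂ) :
    ∑ s ∈ Finset.range (M + 1),
      qBinom q M s * q ^ s ^ 2 * B ^ s * qPoch q (B * q ^ (s + 1)) (M - s) = 1 := by
  induction M generalizing B with
  | zero => simp [qBinom_zero_right, qPoch_zero]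
  | succ M ih =>
    have key : ∀ s ∈ Finset.range (M + 1),
        qBinom q (M + 1) (s + 1) * q ^ (s + 1) ^ 2 * B ^ (s + 1) *
            qPoch q (B * q ^ (s + 1 + 1)) (M + 1 - (s + 1)) =
          qBinom q M (s + 1) * q ^ (s + 1) ^ 2 * B ^ (s + 1) *
            qPoch q (B * q ^ (s + 1 + 1)) (M - s) +
          B * q ^ (M + 1) * (qBinom q M s * q ^ s ^ 2 * (B * q) ^ s *
            qPoch q (B * q * q ^ (s + 1)) (M - s)) := by
      intro s hs
      obtain ⟨k, rfl⟩ := Nat.exists_eq_add_of_le (Nat.lt_succ_iff.1 (Finset.mem_range.1 hs))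
      rw [qBinom_succ_succ' hq1, Nat.add_sub_add_right, Nat.add_sub_cancel_left,
        show B * q * q ^ (s + 1) = B * q ^ (s + 1 + 1) by ring]
      ring
    rw [Finset.sum_range_succ', Finset.sum_congr rfl key, Finset.sum_add_distrib,
      ← Finset.mul_sum, ih (B * q), Finset.sum_range_succ,
      qBinom_eq_zero_of_lt q M.lt_succ_self]
    have h2 : ∀ s ∈ Finset.range (M + 1),
        qBinom q M s * q ^ s ^ 2 * B ^ s * qPoch q (B * q ^ (s + 1)) (M + 1 - s) =
          qBinom q M s * q ^ s ^ 2 * B ^ s * qPoch q (B * q ^ (s + 1)) (M - s) *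
            (1 - B * q ^ (M + 1)) := by
      intro s hs
      have hs := Nat.lt_succ_iff.1 (Finset.mem_range.1 hs)
      rw [Nat.succ_sub hs, Nat.succ_eq_add_one, qPoch_succ]
      obtain ⟨k, rfl⟩ := Nat.exists_eq_add_of_le hs
      rw [Nat.add_sub_cancel_left]
      ring
    have h3 := Finset.sum_congr rfl h2
    rw [← Finset.sum_mul, ih B, Finset.sum_range_succ'] at h3
    simp only [Nat.add_sub_add_right, qBinom_zero_right] at h3 ⊢
    linear_combination h3

lemma sum_qBinom_div_qPoch {q : ℂ} (hq1 : ‖q‖ < 1) {B : ℂ} (hB : ∀ k : ℕ, 1 - B * q ^ k ≠ 0)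
    (M : ℕ) :
    ∑ s ∈ Finset.range (M + 1), qBinom q M s * q ^ s ^ 2 * B ^ s / qPoch q B (s + 1) =
      1 / qPoch q B (M + 1) := by
  rw [← sum_qBinom_mul_qPoch hq1 M B, Finset.sum_div]
  refine Finset.sum_congr rfl fun s hs => ?_
  obtain ⟨k, rfl⟩ := Nat.exists_eq_add_of_le (Nat.lt_succ_iff.1 (Finset.mem_range.1 hs))
  rw [Nat.add_sub_cancel_left, show s + k + 1 = (s + 1) + k by ring, qPoch_add q B (s + 1) k]
  have := qPoch_ne_zero hB (s + 1)
  have := qPoch_ne_zero (one_sub_mul_pow_shift_ne_zero hB (s + 1)) k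
  field_simp

/-- `β_N` multiplied by `(q)_N`, for the Bailey pair relative to `A` whose `α_r` is `w r`, up to the
factor `(A)_r / (q)_r`. -/
noncomputable def baileySum (q A : ℂ) (w : ℕ → ℂ) (N : ℕ) : ℂ :=
  ∑ r ∈ Finset.range (N + 1), w r * qBinom q N r / qPoch q (A * q ^ r) (N + 1)

lemma baileySum_eq_sum_range (q A : ℂ) (w : ℕ → ℂ) {N R : ℕ} (h : N ≤ R) :
    baileySum q A w N =
      ∑ r ∈ Finset.range (R + 1), w r * qBinom q N r / qPoch q (A * q ^ r) (N + 1) := by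
  refine Finset.sum_subset (Finset.range_mono (by omega)) fun r _ hr => ?_
  rw [qBinom_eq_zero_of_lt q (by simpa using hr)]
  simp

/-- One step along the Bailey chain. -/
lemma sum_qBinom_mul_baileySum {q : ℂ} (hq1 : ‖q‖ < 1) {A : ℂ}
    (hA : ∀ k : ℕ, 1 - A * q ^ k ≠ 0) (w : ℕ → ℂ) (N : ℕ) :
    ∑ c ∈ Finset.range (N + 1), A ^ c * q ^ c ^ 2 * qBinom q N c * baileySum q A w c =
      baileySum q A (fun r => A ^ r * q ^ r ^ 2 * w r) N := by
  have h1 : ∀ c ∈ Finset.range (N + 1),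
      A ^ c * q ^ c ^ 2 * qBinom q N c * baileySum q A w c =
        ∑ r ∈ Finset.range (N + 1), A ^ c * q ^ c ^ 2 * qBinom q N c *
          (w r * qBinom q c r / qPoch q (A * q ^ r) (c + 1)) := by
    intro c hc
    rw [baileySum_eq_sum_range q A w (Nat.lt_succ_iff.1 (Finset.mem_range.1 hc)), Finset.mul_sum]
  rw [Finset.sum_congr rfl h1, Finset.sum_comm, baileySum]
  refine Finset.sum_congr rfl fun r hr => ?_
  obtain ⟨M, rfl⟩ := Nat.exists_eq_add_of_le (Nat.lt_succ_iff.1 (Finset.mem_range.1 hr))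
  rw [show r + M + 1 = r + (M + 1) by ring, Finset.sum_range_add,
    Finset.sum_eq_zero (s := Finset.range r), zero_add]
  · have hr' := one_sub_mul_pow_shift_ne_zero hA r
    have hB := one_sub_mul_pow_shift_ne_zero hr' r
    rw [qPoch_add q (A * q ^ r) r (M + 1)]
    have h2 := sum_qBinom_div_qPoch hq1 hB M
    have h3 : A ^ r * q ^ r ^ 2 * w r * qBinom q (r + M) r /
        (qPoch q (A * q ^ r) r * qPoch q (A * q ^ r * q ^ r) (M + 1)) =
        A ^ r * q ^ r ^ 2 * w r * qBinom q (r + M) r / qPoch q (A * q ^ r) r *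
        (1 / qPoch q (A * q ^ r * q ^ r) (M + 1)) := by
      rw [div_mul_div_comm, mul_one]
    rw [h3, ← h2, Finset.mul_sum]
    refine Finset.sum_congr rfl fun s hs => ?_
    obtain ⟨t, rfl⟩ := Nat.exists_eq_add_of_le (Nat.lt_succ_iff.1 (Finset.mem_range.1 hs))
    have h4 := qBinom_mul_qBinom hq1 r s t
    rw [show r + s + 1 = r + (s + 1) by ring, qPoch_add q (A * q ^ r) r (s + 1), ← add_assoc r s t]
    have := qPoch_ne_zero hr' r
    have := qPoch_ne_zero hB (s + 1)
    generalize qPoch q (A * q ^ r * q ^ r) (s + 1) = P at *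
    field_simp
    linear_combination (A ^ (r + s) * q ^ (r + s) ^ 2 * w r) * h4
  · intro c hc
    rw [qBinom_eq_zero_of_lt q (Finset.mem_range.1 hc)]
    simp

lemma qBinom_div_qPoch_succ {q : ℂ} (hq1 : ‖q‖ < 1) {A : ℂ}
    (hA : ∀ k : ℕ, 1 - A * q ^ k ≠ 0) {N r : ℕ} (h : r ≤ N) :
    (1 - A * q ^ (2 * (r + 1))) * qBinom q (N + 1) (r + 1) /
        qPoch q (A * q ^ (r + 1)) (N + 2) =
      q ^ (r + 1) * (qBinom q N (r + 1) / qPoch q (A * q * q ^ (r + 1)) (N + 1)) +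
        qBinom q N r / qPoch q (A * q * q ^ r) (N + 1) := by
  have h1 : qPoch q (A * q ^ (r + 1)) (N + 2) =
      (1 - A * q ^ (r + 1)) * qPoch q (A * q * q ^ (r + 1)) (N + 1) := by
    rw [qPoch_succ']
    congr 2
    ring
  have h2 : qPoch q (A * q ^ (r + 1)) (N + 2) =
      qPoch q (A * q * q ^ r) (N + 1) * (1 - A * q ^ (r + N + 2)) := by
    rw [qPoch_succ]
    congr 2 <;> ring
  have n0 := qPoch_ne_zero (one_sub_mul_pow_shift_ne_zero hA (r + 1)) (N + 2)
  have e1 : 1 / qPoch q (A * q * q ^ (r + 1)) (N + 1) =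
      (1 - A * q ^ (r + 1)) / qPoch q (A * q ^ (r + 1)) (N + 2) := by
    rw [h1, eq_comm, div_eq_div_iff] <;> [ring; rwa [← h1]; exact right_ne_zero_of_mul (h1 ▸ n0)]
  have e2 : 1 / qPoch q (A * q * q ^ r) (N + 1) =
      (1 - A * q ^ (r + N + 2)) / qPoch q (A * q ^ (r + 1)) (N + 2) := by
    rw [h2, eq_comm, div_eq_div_iff] <;> [ring; rwa [← h2]; exact left_ne_zero_of_mul (h2 ▸ n0)]
  rw [← mul_one_div (qBinom q N (r + 1)), ← mul_one_div (qBinom q N r), e1, e2]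
  obtain ⟨k, rfl⟩ := Nat.exists_eq_add_of_le h
  have b1 := qBinom_succ_succ' hq1 r k
  have b2 : qBinom q (r + k + 1) (r + 1) =
    q ^ (r + 1) * qBinom q (r + k) (r + 1) + qBinom q (r + k) r := by rw [qBinom]
  field_simp
  linear_combination b2 - A * q ^ (2 * (r + 1)) * b1

/-- Passing from the parameter `A` to `A * q` along the Bailey lattice. -/
lemma baileySum_succ {q : ℂ} (hq1 : ‖q‖ < 1) {A : ℂ}
    (hA : ∀ k : ℕ, 1 - A * q ^ k ≠ 0) (w : ℕ → ℂ) (N : ℕ) :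
    baileySum q A (fun r => w r * (1 - A * q ^ (2 * r))) (N + 1) =
      baileySum q (A * q) (fun r => q ^ r * w r + w (r + 1)) N := by
  have h1 : ∀ r ∈ Finset.range (N + 1),
      w (r + 1) * (1 - A * q ^ (2 * (r + 1))) * qBinom q (N + 1) (r + 1) /
        qPoch q (A * q ^ (r + 1)) (N + 1 + 1) =
      q ^ (r + 1) * w (r + 1) * qBinom q N (r + 1) / qPoch q (A * q * q ^ (r + 1)) (N + 1) +
        w (r + 1) * qBinom q N r / qPoch q (A * q * q ^ r) (N + 1) := by
    intro r hr
    have := qBinom_div_qPoch_succ hq1 hA (Nat.lt_succ_iff.1 (Finset.mem_range.1 hr))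
    rw [mul_assoc, mul_div_assoc, this]
    ring
  have h2 : ∀ r, (q ^ r * w r + w (r + 1)) * qBinom q N r / qPoch q (A * q * q ^ r) (N + 1) =
      q ^ r * w r * qBinom q N r / qPoch q (A * q * q ^ r) (N + 1) +
        w (r + 1) * qBinom q N r / qPoch q (A * q * q ^ r) (N + 1) := fun r => by ring
  simp only [baileySum, h2]
  rw [Finset.sum_range_succ', Finset.sum_congr rfl h1, Finset.sum_add_distrib,
    Finset.sum_add_distrib, Finset.sum_range_succ, Finset.sum_range_succ' (fun r =>
      q ^ r * w r * qBinom q N r / qPoch q (A * q * q ^ r) (N + 1)),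
    qBinom_eq_zero_of_lt q N.lt_succ_self, qPoch_succ' q (A * q ^ 0)]
  have := hA 0
  have h3 : 1 - A ≠ 0 := by simpa using this
  simp only [pow_zero, mul_zero, mul_one, zero_div, add_zero, qBinom_zero_right, one_mul]
  have h4 : w 0 * (1 - A) / ((1 - A) * qPoch q (A * q) (N + 1)) =
      w 0 / qPoch q (A * q) (N + 1) := by
    rw [mul_comm (w 0), mul_div_mul_left _ _ h3]
  rw [h4]
  ring

lemma summable_pow_mul_pow_choose_two (B : ℝ) {r : ℝ} (hr0 : 0 ≤ r) (hr1 : r < 1) :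
    Summable fun n : ℕ => B ^ n * r ^ n.choose 2 := by
  refine summable_of_ratio_norm_eventually_le (r := 1 / 2) (by norm_num) ?_
  have h : Filter.Tendsto (fun n : ℕ => ‖B‖ * r ^ n) Filter.atTop (nhds (‖B‖ * 0)) :=
    (tendsto_pow_atTop_nhds_zero_of_lt_one hr0 hr1).const_mul _
  rw [mul_zero] at h
  filter_upwards [h.eventually_le_const (show (0 : ℝ) < 1 / 2 by norm_num)] with n hn
  have h2 : B ^ (n + 1) * r ^ (n + 1).choose 2 = (B * r ^ n) * (B ^ n * r ^ n.choose 2) := by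
    rw [Nat.choose_succ_succ' n 1, Nat.choose_one_right]
    ring
  rw [h2, norm_mul, norm_mul B, norm_pow r, Real.norm_of_nonneg hr0]
  gcongr

lemma norm_qBinom_le {q : ℂ} (hq1 : ‖q‖ < 1) (M n : ℕ) :
    ‖qBinom q M n‖ ≤ ((1 - ‖q‖)⁻¹) ^ n := by
  have hpos : 0 < 1 - ‖q‖ := by linarith
  induction M generalizing n with
  | zero =>
    cases n with
    | zero => simp [qBinom]
    | succ n => simp only [qBinom, norm_zero]; positivity
  | succ M ih =>
    cases n with
    | zero => simp [qBinom]
    | succ n =>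
      rw [qBinom]
      set K := (1 - ‖q‖)⁻¹ with hK
      have hKpos : 0 < K := by positivity
      have h1 : K * (1 - ‖q‖) = 1 := inv_mul_cancel₀ hpos.ne'
      have h2 : ‖q‖ ^ (n + 1) ≤ ‖q‖ := pow_le_of_le_one (norm_nonneg q) hq1.le n.succ_ne_zero
      calc ‖q ^ (n + 1) * qBinom q M (n + 1) + qBinom q M n‖
          ≤ ‖q‖ ^ (n + 1) * ‖qBinom q M (n + 1)‖ + ‖qBinom q M n‖ := by
            refine (norm_add_le _ _).trans ?_
            rw [norm_mul, norm_pow]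
        _ ≤ ‖q‖ * K ^ (n + 1) + K ^ n := by
            gcongr
            · exact ih _
            · exact ih _
        _ = K ^ (n + 1) := by
            linear_combination -K ^ n * h1

lemma exists_norm_inv_qPoch_le {q : ℂ} (hq1 : ‖q‖ < 1) (A : ℂ) :
    ∃ K : ℝ, 1 ≤ K ∧ ∀ r n : ℕ, ‖(qPoch q (A * q ^ r) n)⁻¹‖ ≤ K ^ n := by
  have h : Filter.Tendsto (fun n : ℕ => ‖(1 - A * q ^ n)⁻¹‖) Filter.atTop
      (nhds ‖(1 - A * 0)⁻¹‖) :=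
    (((tendsto_pow_atTop_nhds_zero_of_norm_lt_one hq1).const_mul A).const_sub 1 |>.inv₀
      (by simp)).norm
  obtain ⟨K, hK⟩ := h.bddAbove_range
  refine ⟨max K 1, le_max_right _ _, fun r n => ?_⟩
  rw [qPoch, ← Finset.prod_inv_distrib, norm_prod]
  calc ∏ k ∈ Finset.range n, ‖(1 - A * q ^ r * q ^ k)⁻¹‖
      ≤ ∏ _k ∈ Finset.range n, max K 1 := by
        refine Finset.prod_le_prod (fun _ _ => norm_nonneg _) fun k _ => ?_
        rw [mul_assoc, ← pow_add]
        exact (hK ⟨r + k, rfl⟩).trans (le_max_left _ _)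
    _ = max K 1 ^ n := by simp

lemma hasSum_qBinom_div_qPoch {q : ℂ} (hq1 : ‖q‖ < 1) (r : ℕ) {C : ℂ}
    (hC : ∀ k : ℕ, 1 - C * q ^ k ≠ 0) :
    HasSum (fun s : ℕ => (-C) ^ s * q ^ s.choose 2 * qBinom q (r + s) s / qPoch q C (r + s + 1))
      1 := by
  set u : ℂ → ℕ → ℕ → ℂ := fun C r s =>
    (-C) ^ s * q ^ s.choose 2 * qBinom q (r + s) s / qPoch q C (r + s + 1) with hu
  obtain ⟨K, hK1, hK⟩ := exists_norm_inv_qPoch_le hq1 C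
  set L := (1 - ‖q‖)⁻¹ with hL
  have hLpos : 0 < L := inv_pos.2 (by linarith)
  have hsum : ∀ r, Summable fun s => K ^ (r + 1) * ((‖C‖ * L * K) ^ s * ‖q‖ ^ s.choose 2) :=
    fun r => (summable_pow_mul_pow_choose_two _ (norm_nonneg q) hq1).mul_left _
  have hbound : ∀ r n s, ‖u (C * q ^ n) r s‖ ≤
      K ^ (r + 1) * ((‖C‖ * L * K) ^ s * ‖q‖ ^ s.choose 2) := by
    intro r n s
    have h1 := hK n (r + s + 1)
    have h2 := norm_qBinom_le hq1 (r + s) s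
    have h3 : ‖C * q ^ n‖ ≤ ‖C‖ := by
      rw [norm_mul, norm_pow]
      exact mul_le_of_le_one_right (norm_nonneg _) (pow_le_one₀ (norm_nonneg _) hq1.le)
    simp only [hu, div_eq_mul_inv]
    rw [norm_mul, norm_mul, norm_mul, norm_pow, norm_neg, norm_pow q]
    calc ‖C * q ^ n‖ ^ s * ‖q‖ ^ s.choose 2 * ‖qBinom q (r + s) s‖ *
          ‖(qPoch q (C * q ^ n) (r + s + 1))⁻¹‖
        ≤ ‖C‖ ^ s * ‖q‖ ^ s.choose 2 * L ^ s * K ^ (r + s + 1) := by gcongr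
      _ = _ := by ring
  have hsu : ∀ r n, Summable (u (C * q ^ n) r) := fun r n =>
    Summable.of_norm_bounded (hsum r) (hbound r n)
  suffices H : ∀ r n, ∑' s, u (C * q ^ n) r s = 1 by
    have := (hsu r 0).hasSum
    rwa [H r 0, pow_zero, mul_one] at this
  have hne := fun n => one_sub_mul_pow_shift_ne_zero hC n
  have hfin : ∀ r, (∀ n, (1 - C * q ^ n) * ∑' s, u (C * q ^ n) r s =
      1 - C * q ^ n * ∑' s, u (C * q ^ (n + 1)) r s) → ∀ n, ∑' s, u (C * q ^ n) r s = 1 := by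
    intro r hrec
    set M := ∑' s, K ^ (r + 1) * ((‖C‖ * L * K) ^ s * ‖q‖ ^ s.choose 2)
    have hM : ∀ n, ‖∑' s, u (C * q ^ n) r s‖ ≤ M := fun n =>
      tsum_of_norm_bounded (hsum r).hasSum (hbound r n)
    have hiter : ∀ n, qPoch q C n * (∑' s, u (C * q ^ 0) r s - 1) =
        (-C) ^ n * q ^ n.choose 2 * (∑' s, u (C * q ^ n) r s - 1) := by
      intro n
      induction n with
      | zero => simp [qPoch_zero]
      | succ n ih =>
        rw [qPoch_succ, Nat.choose_succ_succ' n 1, Nat.choose_one_right]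
        linear_combination (1 - C * q ^ n) * ih + (-C) ^ n * q ^ n.choose 2 * hrec n
    have hzero : ∑' s, u (C * q ^ 0) r s - 1 = 0 := by
      have hlim := ((summable_pow_mul_pow_choose_two (K * ‖C‖) (norm_nonneg q)
        hq1).tendsto_atTop_zero).mul_const (M + 1)
      rw [zero_mul] at hlim
      refine norm_le_zero_iff.1 (ge_of_tendsto' hlim fun n => ?_)
      have e1 := hK 0 n
      rw [pow_zero, mul_one] at e1
      have e2 : ∑' s, u (C * q ^ 0) r s - 1 = (qPoch q C n)⁻¹ *
          ((-C) ^ n * q ^ n.choose 2 * (∑' s, u (C * q ^ n) r s - 1)) := by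
        rw [← hiter, inv_mul_cancel_left₀ (qPoch_ne_zero hC n)]
      have e3 : ‖∑' s, u (C * q ^ n) r s - 1‖ ≤ M + 1 :=
        (norm_sub_le _ _).trans (by rw [norm_one]; exact add_le_add_left (hM n) 1)
      rw [e2, norm_mul, norm_mul, norm_mul, norm_pow, norm_neg, norm_pow]
      calc ‖(qPoch q C n)⁻¹‖ * (‖C‖ ^ n * ‖q‖ ^ n.choose 2 * ‖∑' s, u (C * q ^ n) r s - 1‖)
          ≤ K ^ n * (‖C‖ ^ n * ‖q‖ ^ n.choose 2 * (M + 1)) := by gcongr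
        _ = _ := by ring
    intro n
    induction n with
    | zero => exact sub_eq_zero.1 hzero
    | succ n ih =>
      have h1 := hrec n
      rw [ih] at h1
      by_cases hc : C * q ^ n = 0
      · have h2 : C * q ^ (n + 1) = C * q ^ n := by rw [pow_succ, ← mul_assoc, hc, zero_mul]
        rw [h2, ih]
      · exact mul_left_cancel₀ hc (by linear_combination h1)
  intro r
  have hp : ∀ n m, qPoch q (C * q ^ n) (m + 1) =
      (1 - C * q ^ n) * qPoch q (C * q ^ (n + 1)) m := fun n m => by
    rw [qPoch_succ', mul_assoc, ← pow_succ]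
  have hch : ∀ s : ℕ, (s + 1).choose 2 = s + s.choose 2 := fun s => by
    rw [Nat.choose_succ_succ' s 1, Nat.choose_one_right]
  have hn1 : ∀ n, 1 - C * q ^ n ≠ 0 := hC
  induction r with
  | zero =>
    refine hfin _ fun n => ?_
    have key : ∀ s, (1 - C * q ^ n) * u (C * q ^ n) 0 (s + 1) =
        - (C * q ^ n * u (C * q ^ (n + 1)) 0 s) := by
      intro s
      have e1 := hn1 n
      have e2 := qPoch_ne_zero (hne (n + 1)) (s + 1)
      simp only [hu, zero_add, qBinom_self]
      rw [hp n (s + 1), hch]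
      generalize qPoch q (C * q ^ (n + 1)) (s + 1) = P at *
      field_simp
      ring
    rw [(hsu 0 n).tsum_eq_zero_add, mul_add, ← tsum_mul_left, tsum_congr key, tsum_neg,
      tsum_mul_left, ← sub_eq_add_neg]
    congr 1
    have e1 := hn1 n
    simp [hu, qPoch, qBinom_zero_right, e1]
  | succ r ih =>
    refine hfin _ fun n => ?_
    have key : ∀ s, (1 - C * q ^ n) * u (C * q ^ n) (r + 1) (s + 1) =
        u (C * q ^ (n + 1)) r (s + 1) - C * q ^ n * u (C * q ^ (n + 1)) (r + 1) s := by
      intro s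
      have e1 := hn1 n
      have e2 := qPoch_ne_zero (hne (n + 1)) (r + s + 2)
      have e3 : qBinom q (r + s + 1 + 1) (s + 1) =
        q ^ (s + 1) * qBinom q (r + s + 1) (s + 1) + qBinom q (r + s + 1) s := by rw [qBinom]
      simp only [hu]
      rw [show r + 1 + (s + 1) + 1 = r + s + 2 + 1 by ring, hp n (r + s + 2), hch,
        show r + 1 + (s + 1) = r + s + 1 + 1 by ring, e3,
        show r + (s + 1) + 1 = r + s + 2 by ring, show r + 1 + s + 1 = r + s + 2 by ring,
        show r + (s + 1) = r + s + 1 by ring, show r + 1 + s = r + s + 1 by ring]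
      generalize qPoch q (C * q ^ (n + 1)) (r + s + 2) = P at *
      field_simp
      ring
    have e0 : (1 - C * q ^ n) * u (C * q ^ n) (r + 1) 0 = u (C * q ^ (n + 1)) r 0 := by
      have e1 := hn1 n
      have e2 := qPoch_ne_zero (hne (n + 1)) (r + 1)
      simp only [hu, add_zero, qBinom_zero_right]
      rw [hp n (r + 1)]
      generalize qPoch q (C * q ^ (n + 1)) (r + 1) = P at *
      field_simp
    rw [(hsu (r + 1) n).tsum_eq_zero_add, mul_add, ← tsum_mul_left, tsum_congr key, e0,
      Summable.tsum_sub ((summable_nat_add_iff 1).2 (hsu r (n + 1)))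
        ((hsu (r + 1) (n + 1)).mul_left _), tsum_mul_left, ← add_sub_assoc,
      ← (hsu r (n + 1)).tsum_eq_zero_add, ih (n + 1)]

lemma tsum_mul_baileySum {q : ℂ} (hq1 : ‖q‖ < 1) {A : ℂ} (hA : ∀ k : ℕ, 1 - A * q ^ k ≠ 0)
    {w : ℕ → ℂ} {W E : ℝ} (hE : 0 ≤ E) (hw : ∀ r, ‖w r‖ ≤ W * E ^ r) :
    ∑' N : ℕ, (-1) ^ N * q ^ N.choose 2 * A ^ N * baileySum q A w N =
      ∑' r : ℕ, (-1) ^ r * q ^ r.choose 2 * A ^ r * w r := by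
  obtain ⟨K, hK1, hK⟩ := exists_norm_inv_qPoch_le hq1 A
  set L := max 1 (1 - ‖q‖)⁻¹ with hL
  have hL1 : 1 ≤ L := le_max_left _ _
  set D := max 1 E with hD
  have hD1 : 1 ≤ D := le_max_left _ _
  have hW : 0 ≤ W := by simpa using (norm_nonneg _).trans (hw 0)
  set g : ℕ → ℕ → ℂ := fun N r => (-1) ^ N * q ^ N.choose 2 * A ^ N *
    (w r * qBinom q N r / qPoch q (A * q ^ r) (N + 1)) with hg
  have hg0 : ∀ N r, N < r → g N r = 0 := fun N r h => by
    simp [hg, qBinom_eq_zero_of_lt q h]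
  have hgb : ∀ N r, ‖g N r‖ ≤
      W * K * ((2 * ‖A‖ * D * L * K) ^ N * ‖q‖ ^ N.choose 2) * (1 / 2) ^ r := by
    intro N r
    rcases lt_or_ge N r with h | h
    · rw [hg0 N r h, norm_zero]
      positivity
    · have h1 : ‖w r‖ ≤ W * D ^ N := by
        refine (hw r).trans ?_
        gcongr
        calc E ^ r ≤ D ^ r := by gcongr; exact le_max_right _ _
          _ ≤ D ^ N := pow_le_pow_right₀ hD1 h
      have h2 : ‖qBinom q N r‖ ≤ L ^ N := by
        refine (norm_qBinom_le hq1 N r).trans ?_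
        have : 0 < 1 - ‖q‖ := by linarith
        calc ((1 - ‖q‖)⁻¹) ^ r ≤ L ^ r := by gcongr; exact le_max_right _ _
          _ ≤ L ^ N := pow_le_pow_right₀ hL1 h
      have h3 := hK r (N + 1)
      have h4 : 1 ≤ (2 : ℝ) ^ N * (1 / 2) ^ r := by
        obtain ⟨k, rfl⟩ := Nat.exists_eq_add_of_le h
        rw [pow_add, mul_right_comm, ← mul_pow]
        norm_num
        exact one_le_pow₀ (by norm_num)
      simp only [hg, div_eq_mul_inv]
      rw [norm_mul, norm_mul, norm_mul, norm_mul, norm_mul, norm_pow, norm_neg, norm_one, one_pow,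
        one_mul, norm_pow, norm_pow]
      calc ‖q‖ ^ N.choose 2 * ‖A‖ ^ N * (‖w r‖ * ‖qBinom q N r‖ *
            ‖(qPoch q (A * q ^ r) (N + 1))⁻¹‖)
          ≤ ‖q‖ ^ N.choose 2 * ‖A‖ ^ N * (W * D ^ N * L ^ N * K ^ (N + 1)) := by gcongr
        _ ≤ ‖q‖ ^ N.choose 2 * ‖A‖ ^ N * (W * D ^ N * L ^ N * K ^ (N + 1)) *
            ((2 : ℝ) ^ N * (1 / 2) ^ r) := le_mul_of_one_le_right (by positivity) h4
        _ = _ := by ring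
  have hsumm : Summable (Function.uncurry g) := by
    refine Summable.of_norm_bounded (Summable.mul_of_nonneg
      ((summable_pow_mul_pow_choose_two (2 * ‖A‖ * D * L * K) (norm_nonneg q) hq1).mul_left (W * K))
      (summable_geometric_of_lt_one (r := 1 / 2) (by norm_num) (by norm_num)) ?_ ?_)
      fun Nr => hgb Nr.1 Nr.2
    · intro N
      simp only [Pi.zero_apply]
      positivity
    · intro r
      simp only [Pi.zero_apply]
      positivity
  have hrow : ∀ N, ∑' r, g N r = (-1) ^ N * q ^ N.choose 2 * A ^ N * baileySum q A w N := by
    intro N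
    rw [tsum_eq_sum (s := Finset.range (N + 1)) fun r hr => hg0 N r (by simpa using hr),
      baileySum, Finset.mul_sum]
  have hcol : ∀ r, ∑' N, g N r = (-1) ^ r * q ^ r.choose 2 * A ^ r * w r := by
    intro r
    have hsr : Summable fun N => g N r := hsumm.prod_symm.prod_factor r
    rw [← hsr.sum_add_tsum_nat_add r, Finset.sum_eq_zero fun N hN => hg0 N r (Finset.mem_range.1 hN),
      zero_add]
    have hr' := one_sub_mul_pow_shift_ne_zero hA r
    have key : ∀ s, g (s + r) r = (-1) ^ r * q ^ r.choose 2 * A ^ r * w r *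
        ((-(A * q ^ r)) ^ s * q ^ s.choose 2 * qBinom q (r + s) s /
          qPoch q (A * q ^ r) (r + s + 1)) := by
      intro s
      have hch : (s + r).choose 2 = s.choose 2 + r.choose 2 + r * s := by
        induction s with
        | zero => simp
        | succ s ih =>
          rw [show s + 1 + r = s + r + 1 by ring, Nat.choose_succ_succ' (s + r) 1,
            Nat.choose_succ_succ' s 1, Nat.choose_one_right, Nat.choose_one_right, ih]
          ring
      have hsym : qBinom q (s + r) r = qBinom q (r + s) s := by
        rw [add_comm s r, qBinom_add_eq_div hq1, add_comm r s, qBinom_add_eq_div hq1,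
          mul_comm (qPoch q q s)]
      simp only [hg]
      rw [hsym, hch, add_comm s r]
      ring
    rw [tsum_congr key, tsum_mul_left, (hasSum_qBinom_div_qPoch hq1 r hr').tsum_eq, mul_one]
  rw [← tsum_congr hrow, ← tsum_congr hcol]
  exact hsumm.tsum_comm.symm

/-- The weights of the Bailey pair obtained from the unit pair by `i` steps along the chain. -/
noncomputable def chainWeight (q x : ℂ) (i r : ℕ) : ℂ :=
  (-1) ^ r * q ^ r.choose 2 * (x ^ (i * r) * q ^ (i * r ^ 2))

lemma chainWeight_succ (q x : ℂ) (i r : ℕ) :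
    chainWeight q x (i + 1) r = x ^ r * q ^ r ^ 2 * chainWeight q x i r := by
  simp only [chainWeight]
  ring

lemma baileySum_chainWeight_zero {q : ℂ} (hq1 : ‖q‖ < 1) {x : ℂ}
    (hx : ∀ k : ℕ, 1 - x * q ^ k ≠ 0) (N : ℕ) :
    baileySum q x (fun r => chainWeight q x 0 r * (1 - x * q ^ (2 * r))) N =
      if N = 0 then 1 else 0 := by
  cases N with
  | zero =>
    have : 1 - x ≠ 0 := by simpa using hx 0
    simp [baileySum, chainWeight, qBinom_zero_right, qPoch, this]
  | succ N =>
    rw [baileySum_succ hq1 hx, if_neg N.succ_ne_zero, baileySum]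
    refine Finset.sum_eq_zero fun r _ => ?_
    have : q ^ r * chainWeight q x 0 r + chainWeight q x 0 (r + 1) = 0 := by
      simp only [chainWeight, Nat.choose_succ_succ' r 1, Nat.choose_one_right]
      ring
    rw [this]
    simp

lemma baileySum_chainWeight_succ {q : ℂ} (hq1 : ‖q‖ < 1) {x : ℂ}
    (hx : ∀ k : ℕ, 1 - x * q ^ k ≠ 0) (i N : ℕ) :
    baileySum q x (fun r => chainWeight q x (i + 1) r * (1 - x * q ^ (2 * r))) N =
      ∑ c ∈ Finset.range (N + 1), x ^ c * q ^ c ^ 2 * qBinom q N c *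
        baileySum q x (fun r => chainWeight q x i r * (1 - x * q ^ (2 * r))) c := by
  rw [sum_qBinom_mul_baileySum hq1 hx]
  simp only [chainWeight_succ, mul_assoc]

lemma baileySum_chainWeight_one {q : ℂ} (hq1 : ‖q‖ < 1) {x : ℂ}
    (hx : ∀ k : ℕ, 1 - x * q ^ k ≠ 0) (N : ℕ) :
    baileySum q x (fun r => chainWeight q x 1 r * (1 - x * q ^ (2 * r))) N = 1 := by
  rw [baileySum_chainWeight_succ hq1 hx 0 N, Finset.sum_eq_single 0]
  · simp [baileySum_chainWeight_zero hq1 hx, qBinom_zero_right]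
  · intro c _ hc
    simp [baileySum_chainWeight_zero hq1 hx, hc]
  · simp

/-- The factor of the summand of `K_m^{(a)}(x)` that depends on `c_{j+1}` and `c_{j+2} = N`. -/
noncomputable def linkTerm (a : ℕ) (q x : ℂ) (j N c : ℕ) : ℂ :=
  x ^ c * q ^ (c ^ 2 + if a ≤ j then c else 0) * qBinom q (N + if j + 1 = a then 1 else 0) c

/-- The sum over `c_1, …, c_j` of the product of the link terms, with `c_{j+1} = N` fixed. -/
noncomputable def innerSum (a : ℕ) (q x : ℂ) : ℕ → ℕ → ℂ
  | 0, _ => 1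
  | j + 1, N => ∑ c ∈ Finset.range ((N + if j + 1 = a then 1 else 0) + 1),
      linkTerm a q x j N c * innerSum a q x j c

lemma innerSum_eq_baileySum_of_le {q : ℂ} (hq1 : ‖q‖ < 1) {x : ℂ}
    (hx : ∀ k : ℕ, 1 - x * q ^ k ≠ 0) {a j : ℕ} (h : j ≤ a) (N : ℕ) :
    innerSum a q x j N = baileySum q x
      (fun r => chainWeight q x (j + 1) r * (1 - x * q ^ (2 * r))) (N + if j = a then 1 else 0) := by
  induction j generalizing N with
  | zero => rw [innerSum, baileySum_chainWeight_one hq1 hx]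
  | succ j ih =>
    rw [innerSum, baileySum_chainWeight_succ hq1 hx (j + 1)]
    refine Finset.sum_congr rfl fun c _ => ?_
    rw [ih (by omega), if_neg (show j ≠ a by omega), linkTerm, if_neg (show ¬ a ≤ j by omega)]
    simp only [add_zero]

lemma innerSum_add_eq_baileySum {q : ℂ} (hq1 : ‖q‖ < 1) {x : ℂ}
    (hx : ∀ k : ℕ, 1 - x * q ^ k ≠ 0) (a i N : ℕ) :
    innerSum a q x (a + i) N = baileySum q (x * q) (fun r => (x * q) ^ (i * r) * q ^ (i * r ^ 2) *
      (q ^ r * chainWeight q x (a + 1) r + chainWeight q x (a + 1) (r + 1))) N := by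
  have hx' : ∀ k : ℕ, 1 - x * q * q ^ k ≠ 0 := by
    simpa using one_sub_mul_pow_shift_ne_zero hx 1
  induction i generalizing N with
  | zero =>
    rw [add_zero, innerSum_eq_baileySum_of_le hq1 hx le_rfl, if_pos rfl, baileySum_succ hq1 hx]
    simp
  | succ i ih =>
    have h1 : ∀ r, (x * q) ^ ((i + 1) * r) * q ^ ((i + 1) * r ^ 2) *
        (q ^ r * chainWeight q x (a + 1) r + chainWeight q x (a + 1) (r + 1)) =
      (x * q) ^ r * q ^ r ^ 2 * ((x * q) ^ (i * r) * q ^ (i * r ^ 2) *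
        (q ^ r * chainWeight q x (a + 1) r + chainWeight q x (a + 1) (r + 1))) := fun r => by ring
    simp only [h1]
    rw [← sum_qBinom_mul_baileySum hq1 hx', ← add_assoc, innerSum,
      if_neg (show a + i + 1 ≠ a by omega), add_zero]
    refine Finset.sum_congr rfl fun c _ => ?_
    rw [ih, linkTerm, if_neg (show a + i + 1 ≠ a by omega), if_pos (Nat.le_add_right a i), add_zero]
    ring

lemma summable_prod_apply {G : ℕ → ℝ} (hG0 : ∀ n, 0 ≤ G n) (hG : Summable G) (p : ℕ) :
    Summable fun c : Fin p → ℕ => ∏ j, G (c j) := by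
  induction p with
  | zero => exact Summable.of_finite
  | succ p ih =>
    rw [← (Fin.snocEquiv fun _ : Fin (p + 1) => ℕ).summable_iff]
    refine (hG.mul_of_nonneg ih hG0 fun c => Finset.prod_nonneg fun j _ => hG0 _).congr fun Nc => ?_
    simp [Fin.prod_univ_castSucc, Fin.snocEquiv, mul_comm]

lemma summable_mul_prod_castSucc {Φ G : ℕ → ℝ} (hΦ0 : ∀ n, 0 ≤ Φ n) (hΦ : Summable Φ)
    (hG0 : ∀ n, 0 ≤ G n) (hG : Summable G) (p : ℕ) :
    Summable fun c : Fin (p + 1) → ℕ => Φ (c (Fin.last p)) * ∏ j : Fin p, G (c j.castSucc) := by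
  rw [← (Fin.snocEquiv fun _ : Fin (p + 1) => ℕ).summable_iff]
  refine (hΦ.mul_of_nonneg (summable_prod_apply hG0 hG p) hΦ0
    fun c => Finset.prod_nonneg fun j _ => hG0 _).congr fun Nc => ?_
  simp [Fin.snocEquiv]

/-- A bound for the link terms that is uniform in the outer index. -/
noncomputable def linkBound (R r : ℝ) (c : ℕ) : ℝ := (R * (1 - r)⁻¹) ^ c * r ^ c.choose 2

lemma linkBound_nonneg {R r : ℝ} (hR : 0 ≤ R) (hr0 : 0 ≤ r) (hr1 : r < 1) (c : ℕ) :
    0 ≤ linkBound R r c := by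
  have : 0 < 1 - r := by linarith
  rw [linkBound]
  positivity

lemma summable_linkBound (R : ℝ) {r : ℝ} (hr0 : 0 ≤ r) (hr1 : r < 1) :
    Summable (linkBound R r) := summable_pow_mul_pow_choose_two _ hr0 hr1

lemma choose_two_le_sq (c : ℕ) : c.choose 2 ≤ c ^ 2 := by
  rw [Nat.choose_two_right, sq]
  exact (Nat.div_le_self _ _).trans (Nat.mul_le_mul_left _ (Nat.sub_le _ _))

lemma norm_linkTerm_le {q x : ℂ} (hq1 : ‖q‖ < 1) {R : ℝ} (hx : ‖x‖ ≤ R) (a j N c : ℕ) :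
    ‖linkTerm a q x j N c‖ ≤ linkBound R ‖q‖ c := by
  have hR : 0 ≤ R := (norm_nonneg x).trans hx
  have : 0 < 1 - ‖q‖ := by linarith
  rw [linkTerm, linkBound, norm_mul, norm_mul, norm_pow, norm_pow]
  calc ‖x‖ ^ c * ‖q‖ ^ (c ^ 2 + if a ≤ j then c else 0) *
        ‖qBinom q (N + if j + 1 = a then 1 else 0) c‖
      ≤ R ^ c * ‖q‖ ^ c.choose 2 * ((1 - ‖q‖)⁻¹) ^ c := by
        gcongr ?_ * ?_ * ?_
        · gcongr
        · exact pow_le_pow_of_le_one (norm_nonneg q) hq1.le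
            ((choose_two_le_sq c).trans (Nat.le_add_right _ _))
        · exact norm_qBinom_le hq1 _ _
    _ = _ := by ring

/-- The product of all link terms. -/
noncomputable def chainTerm (p a : ℕ) (q x : ℂ) (c : Fin (p + 1) → ℕ) : ℂ :=
  ∏ j : Fin p, linkTerm a q x j (c j.succ) (c j.castSucc)

lemma norm_mul_chainTerm_le {q x : ℂ} (hq1 : ‖q‖ < 1) {R : ℝ} (hx : ‖x‖ ≤ R) {φ : ℕ → ℂ}
    {Φ : ℕ → ℝ} (hφ : ∀ n, ‖φ n‖ ≤ Φ n) (p a : ℕ) (c : Fin (p + 1) → ℕ) :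
    ‖φ (c (Fin.last p)) * chainTerm p a q x c‖ ≤
      Φ (c (Fin.last p)) * ∏ j : Fin p, linkBound R ‖q‖ (c j.castSucc) := by
  rw [norm_mul, chainTerm, norm_prod]
  refine mul_le_mul (hφ _) (Finset.prod_le_prod (fun _ _ => norm_nonneg _)
    fun j _ => norm_linkTerm_le hq1 hx _ _ _ _) (Finset.prod_nonneg fun _ _ => norm_nonneg _)
    ((norm_nonneg _).trans (hφ _))

lemma hasSum_mul_chainTerm {q : ℂ} (hq1 : ‖q‖ < 1) (x : ℂ) (a p : ℕ) {φ : ℕ → ℂ}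
    {Φ : ℕ → ℝ} (hφ : ∀ n, ‖φ n‖ ≤ Φ n) (hΦ : Summable Φ) :
    HasSum (fun c : Fin (p + 1) → ℕ => φ (c (Fin.last p)) * chainTerm p a q x c)
      (∑' N, φ N * innerSum a q x p N) := by
  have of_fiber : ∀ p, (∀ N, HasSum (fun c : Fin p → ℕ =>
      chainTerm p a q x (Fin.snoc (α := fun _ => ℕ) c N)) (innerSum a q x p N)) →
      ∀ (φ : ℕ → ℂ) (Φ : ℕ → ℝ), (∀ n, ‖φ n‖ ≤ Φ n) → Summable Φ →
      HasSum (fun c : Fin (p + 1) → ℕ => φ (c (Fin.last p)) * chainTerm p a q x c)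
        (∑' N, φ N * innerSum a q x p N) := by
    intro p h φ Φ hφ hΦ
    have hs : Summable fun c : Fin (p + 1) → ℕ =>
        φ (c (Fin.last p)) * chainTerm p a q x c :=
      Summable.of_norm_bounded (summable_mul_prod_castSucc
        (fun n => (norm_nonneg _).trans (hφ n)) hΦ
        (linkBound_nonneg (norm_nonneg x) (norm_nonneg q) hq1)
        (summable_linkBound _ (norm_nonneg q) hq1) p)
        (norm_mul_chainTerm_le hq1 le_rfl hφ p a)
    have hs' := ((Fin.snocEquiv fun _ : Fin (p + 1) => ℕ).hasSum_iff).2 hs.hasSum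
    have := hs'.prod_fiberwise (g := fun N => φ N * innerSum a q x p N) fun N => by
      simpa [Fin.snocEquiv] using (h N).mul_left (φ N)
    rw [this.tsum_eq]
    exact hs.hasSum
  refine of_fiber p ?_ φ Φ hφ hΦ
  clear hφ hΦ
  induction p with
  | zero =>
    intro N
    simpa only [chainTerm, innerSum, Finset.univ_eq_empty, Finset.prod_empty] using
      hasSum_unique fun c : Fin 0 → ℕ => chainTerm 0 a q x (Fin.snoc (α := fun _ => ℕ) c N)
  | succ p ih =>
    intro N
    have h := of_fiber p ih (linkTerm a q x p N) _ (norm_linkTerm_le hq1 le_rfl a p N)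
      (summable_linkBound _ (norm_nonneg q) hq1)
    rw [tsum_eq_sum (s := Finset.range ((N + if p + 1 = a then 1 else 0) + 1))] at h
    · rw [innerSum]
      refine h.congr_fun ?_
      intro c
      simp only [chainTerm, Fin.prod_univ_castSucc (n := p), Fin.succ_castSucc, Fin.snoc_castSucc,
        Fin.succ_last, Fin.snoc_last, Fin.val_castSucc, Fin.val_last]
      rw [mul_comm]
    · intro c hc
      rw [linkTerm, qBinom_eq_zero_of_lt q (by simpa using hc)]
      simp

lemma Kterm_eq (p a : ℕ) (q x : ℂ) (c : Fin (p + 1) → ℕ) :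
    Kterm p a q x c = ((-1) ^ c (Fin.last p) * q ^ (c (Fin.last p)).choose 2 *
      (x * q) ^ c (Fin.last p)) * chainTerm p a q x c := by
  have h : c (Fin.last p) * (c (Fin.last p) + 1) / 2 =
      (c (Fin.last p)).choose 2 + c (Fin.last p) := by
    have h1 := Nat.choose_two_right (c (Fin.last p) + 1)
    rw [Nat.choose_succ_succ' _ 1, Nat.choose_one_right, Nat.add_sub_cancel] at h1
    rw [mul_comm, ← h1, add_comm]
  simp only [Kterm, chainTerm, linkTerm, h, Fin.sum_univ_castSucc, Finset.prod_mul_distrib,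
    Finset.prod_pow_eq_pow_sum, Finset.sum_add_distrib]
  ring

lemma norm_outer_le {q x : ℂ} (hq1 : ‖q‖ < 1) {R : ℝ} (hx : ‖x‖ ≤ R) (n : ℕ) :
    ‖(-1) ^ n * q ^ n.choose 2 * (x * q) ^ n‖ ≤ R ^ n * ‖q‖ ^ n.choose 2 := by
  have h : ‖x * q‖ ≤ R := by
    rw [norm_mul]
    exact (mul_le_of_le_one_right (norm_nonneg x) hq1.le).trans hx
  rw [norm_mul, norm_mul, norm_pow, norm_neg, norm_one, one_pow, one_mul, norm_pow, norm_pow,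
    mul_comm]
  gcongr

lemma hasSum_Kterm {q : ℂ} (hq1 : ‖q‖ < 1) (x : ℂ) (p a : ℕ) :
    HasSum (Kterm p a q x)
      (∑' N : ℕ, (-1) ^ N * q ^ N.choose 2 * (x * q) ^ N * innerSum a q x p N) := by
  simp only [funext (Kterm_eq p a q x)]
  exact hasSum_mul_chainTerm (φ := fun n => (-1) ^ n * q ^ n.choose 2 * (x * q) ^ n)
    (Φ := fun n => ‖x‖ ^ n * ‖q‖ ^ n.choose 2) hq1 x a p (norm_outer_le hq1 le_rfl)
    (summable_pow_mul_pow_choose_two _ (norm_nonneg q) hq1)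

lemma continuous_tsum_of_ball {ι : Type*} {f : ι → ℂ → ℂ} (hf : ∀ i, Continuous (f i))
    {u : ℝ → ι → ℝ} (hu : ∀ R, 0 ≤ R → Summable (u R))
    (hfu : ∀ R i x, ‖x‖ ≤ R → ‖f i x‖ ≤ u R i) : Continuous fun x => ∑' i, f i x := by
  refine continuous_iff_continuousAt.2 fun x => ?_
  have h : ContinuousOn (fun x => ∑' i, f i x) (Metric.ball 0 (‖x‖ + 1)) :=
    continuousOn_tsum (fun i => (hf i).continuousOn) (hu (‖x‖ + 1) (by positivity))
      fun i y hy => hfu _ i y (mem_ball_zero_iff.1 hy).le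
  exact h.continuousAt (Metric.isOpen_ball.mem_nhds (by simp))

lemma continuous_tsum_Kterm {q : ℂ} (hq1 : ‖q‖ < 1) (p a : ℕ) :
    Continuous fun x => ∑' c, Kterm p a q x c := by
  refine continuous_tsum_of_ball (u := fun R c => R ^ c (Fin.last p) *
    ‖q‖ ^ (c (Fin.last p)).choose 2 * ∏ j : Fin p, linkBound R ‖q‖ (c j.castSucc)) ?_ ?_ ?_
  · intro c
    unfold Kterm
    fun_prop
  · intro R hR
    exact summable_mul_prod_castSucc (Φ := fun n => R ^ n * ‖q‖ ^ n.choose 2)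
      (fun n => by positivity)
      (summable_pow_mul_pow_choose_two _ (norm_nonneg q) hq1)
      (linkBound_nonneg hR (norm_nonneg q) hq1) (summable_linkBound _ (norm_nonneg q) hq1) p
  · intro R c x hx
    rw [Kterm_eq]
    exact norm_mul_chainTerm_le (φ := fun n => (-1) ^ n * q ^ n.choose 2 * (x * q) ^ n)
      (Φ := fun n => R ^ n * ‖q‖ ^ n.choose 2) hq1 hx (norm_outer_le hq1 hx) p a c

lemma continuous_tsum_theta {q : ℂ} (hq1 : ‖q‖ < 1) {m : ℕ} (hm : 0 < m) (b d e : ℕ) :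
    Continuous fun x : ℂ => ∑' k : ℕ, (q ^ (m * k ^ 2 + b * k) * x ^ (m * k) -
      q ^ (m * k ^ 2 + d * k + 1 + e) * x ^ (m * k + 1 + e)) := by
  refine continuous_tsum_of_ball (u := fun R k => (1 + R ^ (1 + e)) *
    ((R ^ m) ^ k * ‖q‖ ^ k.choose 2)) (fun k => by fun_prop)
    (fun R hR => (summable_pow_mul_pow_choose_two _ (norm_nonneg q) hq1).mul_left _) ?_
  intro R k x hx
  have hR : 0 ≤ R := (norm_nonneg x).trans hx
  have hk : k.choose 2 ≤ m * k ^ 2 :=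
    (choose_two_le_sq k).trans (Nat.le_mul_of_pos_left _ hm)
  refine (norm_sub_le _ _).trans ?_
  rw [norm_mul, norm_mul, norm_pow, norm_pow, norm_pow, norm_pow]
  calc _ ≤ ‖q‖ ^ k.choose 2 * R ^ (m * k) + ‖q‖ ^ k.choose 2 * R ^ (m * k + 1 + e) := by
        gcongr ?_ * ?_ + ?_ * ?_
        · exact pow_le_pow_of_le_one (norm_nonneg q) hq1.le (by omega)
        · gcongr
        · exact pow_le_pow_of_le_one (norm_nonneg q) hq1.le (by omega)
        · gcongr
    _ = _ := by ring

lemma dense_setOf_one_sub_mul_pow_ne_zero (q : ℂ) :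
    Dense {x : ℂ | ∀ k : ℕ, 1 - x * q ^ k ≠ 0} := by
  refine ((Set.countable_range fun k : ℕ => (q ^ k)⁻¹).dense_compl ℝ).mono ?_
  intro x hx k hk
  exact hx ⟨k, (eq_inv_of_mul_eq_one_left (sub_eq_zero.1 hk).symm).symm⟩

lemma tsum_innerSum_eq_theta {q : ℂ} (hq1 : ‖q‖ < 1) {x : ℂ}
    (hx : ∀ k : ℕ, 1 - x * q ^ k ≠ 0) (a i : ℕ) :
    ∑' N : ℕ, (-1) ^ N * q ^ N.choose 2 * (x * q) ^ N * innerSum a q x (a + i) N =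
      ∑' k : ℕ, (q ^ ((a + i + 2) * k ^ 2 + (i + 1) * k) * x ^ ((a + i + 2) * k) -
          q ^ ((a + i + 2) * k ^ 2 + (a + i + 2 + 1 + a) * k + 1 + a) *
            x ^ ((a + i + 2) * k + 1 + a)) := by
  have hx' : ∀ k : ℕ, 1 - x * q * q ^ k ≠ 0 := by
    simpa using one_sub_mul_pow_shift_ne_zero hx 1
  have hpow : ∀ r : ℕ, q ^ r ^ 2 = q ^ r.choose 2 * q ^ r.choose 2 * q ^ r := by
    intro r
    rw [← pow_add, ← pow_add]
    congr 1
    induction r with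
    | zero => rfl
    | succ r ih =>
      rw [Nat.choose_succ_succ' r 1, Nat.choose_one_right]
      linarith
  have hsq : ∀ r : ℕ, ((-1 : ℂ) ^ r) * (-1) ^ r = 1 := fun r => by
    rw [← mul_pow]
    norm_num
  have hw : ∀ r, q ^ r * chainWeight q x (a + 1) r + chainWeight q x (a + 1) (r + 1) =
      (-1) ^ r * q ^ r.choose 2 * q ^ r * (x ^ ((a + 1) * r) * q ^ ((a + 1) * r ^ 2) *
        (1 - x ^ (a + 1) * q ^ ((a + 1) * (2 * r + 1)))) := fun r => by
    simp only [chainWeight, Nat.choose_succ_succ' r 1, Nat.choose_one_right]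
    ring
  simp only [innerSum_add_eq_baileySum hq1 hx]
  rw [tsum_mul_baileySum hq1 hx' (W := 1 + ‖x‖ ^ (a + 1)) (E := ‖x‖ ^ (i + a + 1))
    (by positivity)]
  · refine tsum_congr fun r => ?_
    rw [hw]
    have e1 : q ^ ((a + i + 2) * r ^ 2 + (i + 1) * r) =
        q ^ r ^ 2 * q ^ (i * r) * q ^ (i * r ^ 2) * q ^ ((a + 1) * r ^ 2) * q ^ r := by ring
    have e2 : q ^ ((a + i + 2) * r ^ 2 + (a + i + 2 + 1 + a) * r + 1 + a) =
        q ^ r ^ 2 * q ^ (i * r) * q ^ (i * r ^ 2) * q ^ ((a + 1) * r ^ 2) * q ^ r *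
          q ^ ((a + 1) * (2 * r + 1)) := by ring
    rw [e1, e2, hpow r]
    generalize q ^ r.choose 2 = Q
    linear_combination (x ^ ((a + i + 2) * r) * Q * Q * q ^ r * q ^ (i * r) * q ^ (i * r ^ 2) *
      q ^ ((a + 1) * r ^ 2) * q ^ r * (1 - x ^ (a + 1) * q ^ ((a + 1) * (2 * r + 1)))) * hsq r
  · intro r
    have hle : ∀ n : ℕ, ‖q‖ ^ n ≤ 1 := fun n => pow_le_one₀ (norm_nonneg q) hq1.le
    have h1 : ‖1 - x ^ (a + 1) * q ^ ((a + 1) * (2 * r + 1))‖ ≤ 1 + ‖x‖ ^ (a + 1) := by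
      refine (norm_sub_le _ _).trans ?_
      rw [norm_one, norm_mul, norm_pow, norm_pow]
      gcongr
      exact mul_le_of_le_one_right (by positivity) (hle _)
    rw [hw, mul_pow]
    simp only [norm_mul, norm_pow, norm_neg, norm_one, one_pow, one_mul]
    calc _ ≤ ‖x‖ ^ (i * r) * 1 * 1 * (1 * 1 * (‖x‖ ^ ((a + 1) * r) * 1 * (1 + ‖x‖ ^ (a + 1)))) := by
          gcongr <;> exact hle _
      _ = _ := by ring

/-- for `m ≥ 2`, `0 ≤ a ≤ m−2`, `0 < |q| < 1` and any `x : ℂ`, the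
multiple series `K_m^{(a)}(x)` converges (to its value) and
`K_m^{(a)}(x) = Σ_{k≥0} ( q^{mk²+(m−1−a)k} x^{mk} − q^{mk²+(m+1+a)k+1+a} x^{mk+1+a} )`. -/
theorem stmt3 (m p a : ℕ) (hm : m = p + 2) (ha : a ≤ m - 2) (q x : ℂ)
    (hq0 : q ≠ 0) (hq1 : ‖q‖ < 1) :
    HasSum (fun c : Fin (p + 1) → ℕ => Kterm p a q x c)
      (∑' k : ℕ,
        (q ^ (m * k ^ 2 + (m - 1 - a) * k) * x ^ (m * k) -
          q ^ (m * k ^ 2 + (m + 1 + a) * k + 1 + a) * x ^ (m * k + 1 + a))) := by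
  obtain ⟨i, rfl⟩ : ∃ i, p = a + i := Nat.exists_eq_add_of_le (by omega)
  subst hm
  rw [show a + i + 2 - 1 - a = i + 1 by omega]
  have h : ∑' c, Kterm (a + i) a q x c = _ := congrFun (Continuous.ext_on
    (dense_setOf_one_sub_mul_pow_ne_zero q) (continuous_tsum_Kterm hq1 (a + i) a)
    (continuous_tsum_theta hq1 (Nat.succ_pos (a + i + 1)) (i + 1) (a + i + 2 + 1 + a) a)
    fun y hy => by
      simp only [(hasSum_Kterm hq1 y (a + i) a).tsum_eq]
      exact tsum_innerSum_eq_theta hq1 hy a i) x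
  rw [← h]
  exact (hasSum_Kterm hq1 x (a + i) a).summable.hasSum
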